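/- arXiv:1512.01003 — 9 statements merged into one kernel-verified Lean document; each statement's English description precedes it below -/
import Mathlib

section
/- Let 0 < p < 1, w > 0, and 0 ≤ σ ≤ τ_p(w). Then δ = 0 is a global minimizer of f_{σ,w,p}(δ) = ½(δ−σ)² + w δ^p over δ ∈ [0,∞); moreover, if σ < τ_p(w) then δ = 0 is the unique global minimizer. -/
/-- The scalar GST objective `f_{σ,w,p}(δ) = ½(δ−σ)² + w·δ^p` (real power). -/
noncomputable def fobj (σ w p δ : ℝ) : ℝ := (1 / 2) * (δ - σ) ^ 2 + w * δ ^ p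

/-- The GST threshold `τ_p(w) = (2w(1−p))^{1/(2−p)} + w·p·(2w(1−p))^{(p−1)/(2−p)}`. -/
noncomputable def gstThreshold (p w : ℝ) : ℝ :=
  (2 * w * (1 - p)) ^ (1 / (2 - p)) + w * p * (2 * w * (1 - p)) ^ ((p - 1) / (2 - p))

/-- Bernoulli's inequality for a real exponent `q ≤ 0`. -/
theorem one_add_mul_sub_one_le_rpow_of_nonpos {t q : ℝ} (ht : 0 < t) (hq : q ≤ 0) :
    1 + q * (t - 1) ≤ t ^ q := by
  rw [Real.rpow_def_of_pos ht]
  have hlog := mul_le_mul_of_nonpos_left (Real.log_le_sub_one_of_pos ht) hq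
  linarith [Real.add_one_le_exp (Real.log t * q)]

/-- The threshold is a lower bound of `δ ↦ δ / 2 + w * δ ^ (p - 1)` on the positive reals. -/
theorem gstThreshold_le_half_add_mul_rpow {p w δ : ℝ} (hp1 : p < 1) (hw : 0 < w) (hδ : 0 < δ) :
    gstThreshold p w ≤ δ / 2 + w * δ ^ (p - 1) := by
  have hbase : 0 < 2 * w * (1 - p) := mul_pos (by positivity) (by linarith)
  have hne : 2 - p ≠ 0 := by linarith
  obtain ⟨a, ha⟩ : ∃ a, a = (2 * w * (1 - p)) ^ (1 / (2 - p)) := ⟨_, rfl⟩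
  have ha0 : 0 < a := ha ▸ Real.rpow_pos_of_pos hbase _
  have hpow : (2 * w * (1 - p)) ^ ((p - 1) / (2 - p)) = a ^ (p - 1) := by
    rw [ha, ← Real.rpow_mul hbase.le]
    congr 1
    ring
  have hcrit : a = 2 * w * (1 - p) * a ^ (p - 1) := by
    have h : a ^ (2 - p) = 2 * w * (1 - p) := by
      rw [ha, ← Real.rpow_mul hbase.le, one_div_mul_cancel hne, Real.rpow_one]
    rw [← h, ← Real.rpow_add ha0]
    norm_num
  have hδpow : δ ^ (p - 1) = a ^ (p - 1) * (δ / a) ^ (p - 1) := by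
    rw [← Real.mul_rpow ha0.le (by positivity), mul_div_cancel₀ _ ha0.ne']
  have hbern := one_add_mul_sub_one_le_rpow_of_nonpos (div_pos hδ ha0)
    (show p - 1 ≤ 0 by linarith)
  have hwa : 0 < w * a ^ (p - 1) := mul_pos hw (Real.rpow_pos_of_pos ha0 _)
  have hmul := mul_le_mul_of_nonneg_left hbern hwa.le
  have hδa : δ = 2 * w * (1 - p) * a ^ (p - 1) * (δ / a) := by
    rw [← hcrit, mul_div_cancel₀ _ ha0.ne']
  rw [gstThreshold, hpow, ← ha, hδpow]
  linarith

theorem fobj_sub_fobj_zero {σ w p δ : ℝ} (hp : p ≠ 0) (hδ : 0 < δ) :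
    fobj σ w p δ - fobj σ w p 0 = δ * (δ / 2 + w * δ ^ (p - 1) - σ) := by
  rw [fobj, fobj, Real.zero_rpow hp, Real.rpow_sub_one hδ.ne']
  field_simp
  ring

/-- For `0 < p < 1`, `w > 0` and `0 ≤ σ ≤ τ_p(w)`, `δ = 0` is a global minimizer of
`f_{σ,w,p}` on `[0,∞)`; if moreover `σ < τ_p(w)`, it is the unique global minimizer. -/
theorem zero_isGlobalMin_of_le_gstThreshold (p w σ : ℝ)
    (hp : 0 < p) (hp1 : p < 1) (hw : 0 < w)
    (hσ0 : 0 ≤ σ) (hστ : σ ≤ gstThreshold p w) :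
    (∀ δ : ℝ, 0 ≤ δ → fobj σ w p 0 ≤ fobj σ w p δ) ∧
      (σ < gstThreshold p w →
        ∀ δ : ℝ, 0 ≤ δ → δ ≠ 0 → fobj σ w p 0 < fobj σ w p δ) := by
  have gap : ∀ δ : ℝ, 0 < δ →
      δ * (gstThreshold p w - σ) ≤ fobj σ w p δ - fobj σ w p 0 := fun δ hδ => by
    rw [fobj_sub_fobj_zero hp.ne' hδ]
    exact mul_le_mul_of_nonneg_left
      (sub_le_sub_right (gstThreshold_le_half_add_mul_rpow hp1 hw hδ) σ) hδ.le
  refine ⟨fun δ hδ => ?_, fun hlt δ hδ hne => ?_⟩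
  · rcases hδ.eq_or_lt with rfl | hpos
    · exact le_rfl
    · linarith [gap δ hpos, mul_nonneg hδ (sub_nonneg.2 hστ)]
  · have hpos : 0 < δ := lt_of_le_of_ne hδ hne.symm
    linarith [gap δ hpos, mul_pos hpos (sub_pos.2 hlt)]
end

section
/- Let 0 < p < 1, w > 0, and σ > τ_p(w). Then f_{σ,w,p}(δ) = ½(δ−σ)² + w δ^p has a unique global minimizer δ* over δ ∈ [0,∞); this minimizer satisfies δ* > 0 and the stationary equation δ* − σ + w·p·(δ*)^{p−1} = 0. -/
/-- Above the GST threshold, some positive point beats the origin. -/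
theorem exists_fobj_lt_fobj_zero (p w σ : ℝ) (hp : 0 < p) (hp1 : p < 1) (hw : 0 < w)
    (hστ : gstThreshold p w < σ) : ∃ d : ℝ, 0 < d ∧ d < σ ∧ fobj σ w p d < fobj σ w p 0 := by
  have hB : 0 < 2 * w * (1 - p) := mul_pos (by linarith) (by linarith)
  have hp2 : 2 - p ≠ 0 := by linarith
  set d := (2 * w * (1 - p)) ^ (1 / (2 - p)) with hd
  have hd0 : 0 < d := Real.rpow_pos_of_pos hB _
  have hd1 : (2 * w * (1 - p)) ^ ((p - 1) / (2 - p)) = d ^ (p - 1) := by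
    rw [hd, ← Real.rpow_mul hB.le]
    congr 1
    ring
  have hd2 : d ^ (2 - p) = 2 * w * (1 - p) := by
    rw [hd, ← Real.rpow_mul hB.le, one_div, inv_mul_cancel₀ hp2, Real.rpow_one]
  have hc : 0 < d ^ (p - 1) := Real.rpow_pos_of_pos hd0 _
  have hlin : 2 * w * (1 - p) * d ^ (p - 1) = d := by
    rw [← hd2, ← Real.rpow_add hd0, show 2 - p + (p - 1) = 1 by ring, Real.rpow_one]
  have hpow : d ^ p = d * d ^ (p - 1) := by
    rw [Real.rpow_sub_one hd0.ne']
    field_simp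
  have hτ : d + w * p * d ^ (p - 1) < σ := by
    rw [← hd1]
    exact hστ
  refine ⟨d, hd0, by linarith [mul_pos (mul_pos hw hp) hc], ?_⟩
  simp only [fobj]
  rw [hpow, Real.zero_rpow hp.ne']
  nlinarith [mul_pos hd0 (sub_pos.2 hτ)]

/-- A positive minimizer of the objective over `[0,∞)` is a stationary point. -/
theorem stationary_of_forall_fobj_le (p w σ m : ℝ) (hm : 0 < m)
    (hmin : ∀ δ : ℝ, 0 ≤ δ → fobj σ w p m ≤ fobj σ w p δ) :
    m - σ + w * p * m ^ (p - 1) = 0 := by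
  have hloc : IsLocalMin (fobj σ w p) m := by
    filter_upwards [Ioi_mem_nhds hm] with δ hδ
    exact hmin δ (le_of_lt hδ)
  have hder : HasDerivAt (fobj σ w p) (m - σ + w * p * m ^ (p - 1)) m := by
    have h1 := ((((hasDerivAt_id m).sub_const σ).pow 2).const_mul (1 / 2 : ℝ)).add
      ((Real.hasDerivAt_rpow_const (p := p) (Or.inl hm.ne')).const_mul w)
    refine h1.congr_deriv ?_
    simp
    ring
  exact hloc.hasDerivAt_eq_zero hder

/-- A stationary point with value below that at the origin satisfies a curvature bound. -/
theorem curvature_bound_of_fobj_lt (p w σ m : ℝ) (hp : 0 < p) (hm : 0 < m)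
    (hlt : fobj σ w p m < fobj σ w p 0) (hs : m - σ + w * p * m ^ (p - 1) = 0) :
    w * (1 - p) * m ^ (p - 1) < m / 2 := by
  have hpow : m ^ p = m * m ^ (p - 1) := by
    rw [Real.rpow_sub_one hm.ne']
    field_simp
  simp only [fobj] at hlt
  rw [hpow, Real.zero_rpow hp.ne'] at hlt
  obtain rfl : σ = m + w * p * m ^ (p - 1) := by linarith
  refine lt_of_mul_lt_mul_left ?_ hm.le
  nlinarith

/-- Bernoulli's inequality for exponents in `(-1, 0)`. -/
theorem one_sub_mul_le_rpow_sub_one (p u : ℝ) (hp : 0 < p) (hp1 : p < 1) (hu : 1 < u) :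
    1 - (1 - p) * (u - 1) ≤ u ^ (p - 1) := by
  have hB : u ^ (1 - p) ≤ 1 + (1 - p) * (u - 1) := by
    simpa using rpow_one_add_le_one_add_mul_self (s := u - 1) (by linarith)
      (p := 1 - p) (by linarith) (by linarith)
  have hu0 : 0 < u ^ (1 - p) := Real.rpow_pos_of_pos (by linarith) _
  rw [show p - 1 = -(1 - p) by ring, Real.rpow_neg (by linarith), ← one_div, le_div_iff₀ hu0]
  have ht : 0 < (1 - p) * (u - 1) := mul_pos (by linarith) (by linarith)
  rcases le_total (1 - (1 - p) * (u - 1)) 0 with h | h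
  · nlinarith
  · nlinarith [mul_le_mul_of_nonneg_left hB h]

/-- No stationary point lies to the right of one satisfying the curvature bound. -/
theorem not_lt_of_stationary (p w σ a b : ℝ) (hp : 0 < p) (hp1 : p < 1) (hw : 0 < w) (ha : 0 < a)
    (hab : a < b) (hc : w * (1 - p) * a ^ (p - 1) < a / 2)
    (hsa : a - σ + w * p * a ^ (p - 1) = 0) (hsb : b - σ + w * p * b ^ (p - 1) = 0) : False := by
  have hu : 1 < b / a := (one_lt_div ha).2 hab
  have hB := one_sub_mul_le_rpow_sub_one p (b / a) hp hp1 hu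
  have hb : b = a * (b / a) := by field_simp
  rw [hb, Real.mul_rpow ha.le (by linarith)] at hsb
  generalize b / a = u at *
  have hA : 0 < a ^ (p - 1) := Real.rpow_pos_of_pos ha _
  generalize a ^ (p - 1) = A at *
  have h1 := mul_le_mul_of_nonneg_left hB (mul_pos (mul_pos hw hp) hA).le
  have h2 : p * (w * (1 - p) * A) < a := by
    nlinarith [mul_lt_mul_of_pos_left hc hp, mul_pos ha (sub_pos.2 hp1)]
  have h3 := mul_pos (sub_pos.2 h2) (sub_pos.2 hu)
  nlinarith

/-- The objective attains its minimum over `[0,∞)`. -/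
theorem exists_forall_fobj_le (p w σ : ℝ) (hp : 0 < p) (hw : 0 < w) (hσ : 0 ≤ σ) :
    ∃ m : ℝ, 0 ≤ m ∧ ∀ δ : ℝ, 0 ≤ δ → fobj σ w p m ≤ fobj σ w p δ := by
  have hcont : Continuous (fobj σ w p) := by
    have h := Real.continuous_rpow_const hp.le
    unfold fobj
    fun_prop
  obtain ⟨m, hm, hmin⟩ :=
    isCompact_Icc.exists_isMinOn (Set.nonempty_Icc.2 hσ) hcont.continuousOn
  refine ⟨m, hm.1, fun δ hδ => ?_⟩
  rcases le_total δ σ with h | h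
  · exact hmin ⟨hδ, h⟩
  · refine (hmin (Set.right_mem_Icc.2 hσ)).trans ?_
    have hpow := mul_le_mul_of_nonneg_left (Real.rpow_le_rpow hσ h hp.le) hw.le
    simp only [fobj]
    nlinarith [sq_nonneg (δ - σ)]

/-- For `0 < p < 1`, `w > 0` and `σ > τ_p(w)`, the objective `f_{σ,w,p}` has a unique
global minimizer `δ*` on `[0,∞)`; it satisfies `δ* > 0` and the stationary equation
`δ* − σ + w·p·(δ*)^{p−1} = 0`. -/
theorem exists_unique_globalMin_of_gt_gstThreshold (p w σ : ℝ)
    (hp : 0 < p) (hp1 : p < 1) (hw : 0 < w) (hστ : gstThreshold p w < σ) :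
    ∃ δstar : ℝ, 0 < δstar ∧
      (∀ δ : ℝ, 0 ≤ δ → fobj σ w p δstar ≤ fobj σ w p δ) ∧
      (∀ δ' : ℝ, 0 ≤ δ' → (∀ δ : ℝ, 0 ≤ δ → fobj σ w p δ' ≤ fobj σ w p δ) → δ' = δstar) ∧
      δstar - σ + w * p * δstar ^ (p - 1) = 0 := by
  obtain ⟨d, hd0, hdσ, hd⟩ := exists_fobj_lt_fobj_zero p w σ hp hp1 hw hστ
  have key : ∀ m : ℝ, 0 ≤ m → (∀ δ : ℝ, 0 ≤ δ → fobj σ w p m ≤ fobj σ w p δ) →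
      0 < m ∧ m - σ + w * p * m ^ (p - 1) = 0 ∧ w * (1 - p) * m ^ (p - 1) < m / 2 := by
    intro m hm hmin
    have hlt := (hmin d hd0.le).trans_lt hd
    have hm0 : 0 < m := hm.lt_of_ne (by rintro rfl; exact hlt.false)
    have hs := stationary_of_forall_fobj_le p w σ m hm0 hmin
    exact ⟨hm0, hs, curvature_bound_of_fobj_lt p w σ m hp hm0 hlt hs⟩
  obtain ⟨m, hm, hmin⟩ := exists_forall_fobj_le p w σ hp hw (hd0.trans hdσ).le
  obtain ⟨hm0, hs, hc⟩ := key m hm hmin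
  refine ⟨m, hm0, hmin, fun m' hm' hmin' => ?_, hs⟩
  obtain ⟨hm0', hs', hc'⟩ := key m' hm' hmin'
  rcases lt_trichotomy m' m with h | h | h
  · exact (not_lt_of_stationary p w σ m' m hp hp1 hw hm0' h hc' hs' hs).elim
  · exact h
  · exact (not_lt_of_stationary p w σ m m' hp hp1 hw hm0 h hc hs hs').elim
end

section
/- Fix σ ≥ 0 and 0 < p ≤ 1, and let 0 ≤ w₁ ≤ w₂. Let S_p(σ;w) denote the smallest global minimizer of g_{σ,w,p}(δ) = (δ−σ)² + w δ^p over δ ∈ [0,∞). Then S_p(σ;w₁) ≥ S_p(σ;w₂), i.e., the smallest global minimizer is non-increasing in the weight w. -/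
/-- The scalar objective `g_{σ,w,p}(δ) = (δ−σ)² + w·δ^p` (real power, so `0^p = 0` for `p > 0`). -/
noncomputable def gobj (σ w p δ : ℝ) : ℝ := (δ - σ) ^ 2 + w * δ ^ p

/-- Fix `σ ≥ 0` and `0 < p ≤ 1`, and let `0 ≤ w₁ ≤ w₂`. If `d₁` and `d₂` are the
smallest global minimizers of `g_{σ,w₁,p}` and `g_{σ,w₂,p}` over `[0,∞)`
respectively, then `d₁ ≥ d₂`: the smallest global minimizer is non-increasing in
the weight `w`. -/
theorem smallest_globalMin_antitone_in_weight (σ p w₁ w₂ d₁ d₂ : ℝ)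
    (hσ : 0 ≤ σ) (hp : 0 < p) (hp1 : p ≤ 1) (hw₁ : 0 ≤ w₁) (hw : w₁ ≤ w₂)
    (hd₁ : IsLeast {δ : ℝ | 0 ≤ δ ∧ ∀ x : ℝ, 0 ≤ x → gobj σ w₁ p δ ≤ gobj σ w₁ p x} d₁)
    (hd₂ : IsLeast {δ : ℝ | 0 ≤ δ ∧ ∀ x : ℝ, 0 ≤ x → gobj σ w₂ p δ ≤ gobj σ w₂ p x} d₂) :
    d₂ ≤ d₁ := by
  by_contra! hlt
  refine hlt.not_ge (hd₂.2 ⟨hd₁.1.1, fun x hx => le_trans ?_ (hd₂.1.2 x hx)⟩)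
  have hmin := hd₁.1.2 d₂ hd₂.1.1
  have hpow : d₁ ^ p ≤ d₂ ^ p := Real.rpow_le_rpow hd₁.1.1 hlt.le hp.le
  have hmul := mul_le_mul_of_nonneg_left hpow (sub_nonneg.2 hw)
  unfold gobj at *
  linarith
end

section
/- Fix w ≥ 0 and 0 < p ≤ 1, and let σ₁ ≥ σ₂ ≥ 0. Let S_p(σ;w) denote the smallest global minimizer of g_{σ,w,p}(δ) = (δ−σ)² + w δ^p over δ ∈ [0,∞). Then S_p(σ₁;w) ≥ S_p(σ₂;w), i.e., the smallest global minimizer is non-decreasing in σ. -/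
/-- Fix `w ≥ 0` and `0 < p ≤ 1`, and let `σ₁ ≥ σ₂ ≥ 0`. If `d₁` and `d₂` are the
smallest global minimizers of `g_{σ₁,w,p}` and `g_{σ₂,w,p}` over `[0,∞)`
respectively, then `d₁ ≥ d₂`: the smallest global minimizer is non-decreasing in
`σ`. -/
theorem smallest_globalMin_monotone_in_sigma (w p σ₁ σ₂ d₁ d₂ : ℝ)
    (hw : 0 ≤ w) (hp : 0 < p) (hp1 : p ≤ 1) (hσ₂ : 0 ≤ σ₂) (hσ : σ₂ ≤ σ₁)
    (hd₁ : IsLeast {δ : ℝ | 0 ≤ δ ∧ ∀ x : ℝ, 0 ≤ x → gobj σ₁ w p δ ≤ gobj σ₁ w p x} d₁)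
    (hd₂ : IsLeast {δ : ℝ | 0 ≤ δ ∧ ∀ x : ℝ, 0 ≤ x → gobj σ₂ w p δ ≤ gobj σ₂ w p x} d₂) :
    d₂ ≤ d₁ := by
  by_contra! h
  have h₁ := hd₁.1.2 d₂ hd₂.1.1
  have h₂ := hd₂.1.2 d₁ hd₁.1.1
  have hσeq : σ₁ = σ₂ := by
    refine le_antisymm ?_ hσ
    by_contra! hlt
    unfold gobj at h₁ h₂
    nlinarith [mul_pos (sub_pos.2 hlt) (sub_pos.2 h)]
  subst hσeq
  exact h.ne (hd₁.unique hd₂)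
end

section
/- Let 0 < p ≤ 1, let σ₁ ≥ σ₂ ≥ … ≥ σ_r ≥ 0, and let the weights satisfy 0 ≤ w₁ ≤ w₂ ≤ … ≤ w_r. For each i, let δ_i = S_p(σ_i; w_i) be the smallest global minimizer of g_{σ_i,w_i,p}(δ) = (δ−σ_i)² + w_i δ^p over δ ∈ [0,∞). Then δ₁ ≥ δ₂ ≥ … ≥ δ_r. -/
/-- Theorem 2 of the paper: if `σ₁ ≥ … ≥ σ_r ≥ 0` and the weights satisfy
`0 ≤ w₁ ≤ … ≤ w_r`, then the smallest global minimizers `δ_i = S_p(σ_i; w_i)` of the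
decoupled subproblems `g_{σ_i,w_i,p}` over `[0,∞)` satisfy `δ₁ ≥ δ₂ ≥ … ≥ δ_r`. -/
theorem globalMin_order_preserved (r : ℕ) (p : ℝ) (hp : 0 < p) (hp1 : p ≤ 1)
    (σ w δ : Fin r → ℝ)
    (hσ0 : ∀ i, 0 ≤ σ i) (hσord : ∀ i j : Fin r, i ≤ j → σ j ≤ σ i)
    (hw0 : ∀ i, 0 ≤ w i) (hword : ∀ i j : Fin r, i ≤ j → w i ≤ w j)
    (hδ : ∀ i, IsLeast
      {d : ℝ | 0 ≤ d ∧ ∀ x : ℝ, 0 ≤ x → gobj (σ i) (w i) p d ≤ gobj (σ i) (w i) p x}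
      (δ i)) :
    ∀ i j : Fin r, i ≤ j → δ j ≤ δ i := by
  intro i j hij
  by_contra! hlt
  obtain ⟨⟨hi, hmin_i⟩, -⟩ := hδ i
  obtain ⟨⟨hj, hmin_j⟩, hleast⟩ := hδ j
  have h_i := hmin_i (δ j) hj
  have h_j : gobj (σ j) (w j) p (δ j) < gobj (σ j) (w j) p (δ i) := by
    by_contra! hle
    exact absurd (hleast ⟨hi, fun x hx => hle.trans (hmin_j x hx)⟩) (not_le.mpr hlt)
  have hpow : δ i ^ p ≤ δ j ^ p := Real.rpow_le_rpow hi hlt.le hp.le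
  have hσ := mul_nonneg (sub_nonneg.mpr hlt.le) (sub_nonneg.mpr (hσord i j hij))
  have hw := mul_nonneg (sub_nonneg.mpr (hword i j hij)) (sub_nonneg.mpr hpow)
  unfold gobj at h_i h_j
  linarith
end

section
/- Let 0 < p ≤ 1, let σ₁ ≥ σ₂ ≥ … ≥ σ_r ≥ 0, and let the weights satisfy 0 ≤ w₁ ≤ w₂ ≤ … ≤ w_r. For each i, let δ_i = S_p(σ_i; w_i) be the smallest global minimizer of g_{σ_i,w_i,p}(δ) = (δ−σ_i)² + w_i δ^p over δ ∈ [0,∞). Then the vector (δ₁, …, δ_r) is a global minimizer of the constrained problem: minimize ∑_{i=1}^{r} [(δ_i − σ_i)² + w_i δ_i^p] subject to δ₁ ≥ δ₂ ≥ … ≥ δ_r ≥ 0. -/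
/-- The smallest minimizer of `gobj σ w p` over `[0, ∞)` is monotone in `σ` and antitone in `w`. -/
theorem isLeast_gobj_minimizer_le {p σ₁ σ₂ w₁ w₂ a b : ℝ} (hp : 0 < p) (hσ : σ₂ ≤ σ₁)
    (hw : w₁ ≤ w₂)
    (ha : IsLeast {d : ℝ | 0 ≤ d ∧ ∀ x : ℝ, 0 ≤ x → gobj σ₁ w₁ p d ≤ gobj σ₁ w₁ p x} a)
    (hb : IsLeast {d : ℝ | 0 ≤ d ∧ ∀ x : ℝ, 0 ≤ x → gobj σ₂ w₂ p d ≤ gobj σ₂ w₂ p x} b) :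
    b ≤ a := by
  by_contra! hab
  have hpow : a ^ p < b ^ p := Real.rpow_lt_rpow ha.1.1 hab hp
  have h₁ := ha.1.2 b hb.1.1
  have h₂ := hb.1.2 a ha.1.1
  have hσ_gap : 0 ≤ (b - a) * (σ₁ - σ₂) := mul_nonneg (by linarith) (by linarith)
  have hw_gap : 0 ≤ (w₂ - w₁) * (b ^ p - a ^ p) := mul_nonneg (by linarith) (by linarith)
  unfold gobj at h₁ h₂
  have hσ_eq : σ₁ = σ₂ := by
    have h : (b - a) * (σ₁ - σ₂) = 0 := by linarith
    rcases mul_eq_zero.mp h with h | h <;> linarith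
  have hw_eq : w₁ = w₂ := by
    have h : (w₂ - w₁) * (b ^ p - a ^ p) = 0 := by linarith
    rcases mul_eq_zero.mp h with h | h <;> linarith
  subst hσ_eq hw_eq
  exact absurd (hb.2 ha.1) (not_le.mpr hab)

/-- If `σ₁ ≥ … ≥ σ_r ≥ 0` and `0 ≤ w₁ ≤ … ≤ w_r`, then the vector of smallest global
minimizers `δ_i = S_p(σ_i; w_i)` of the decoupled subproblems is a global minimizer of
the constrained problem: minimize `∑ i, (δ_i − σ_i)² + w_i δ_i^p` subject to
`δ₁ ≥ δ₂ ≥ … ≥ δ_r ≥ 0`. -/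
theorem decoupled_solves_constrained (r : ℕ) (p : ℝ) (hp : 0 < p) (hp1 : p ≤ 1)
    (σ w δ : Fin r → ℝ)
    (hσ0 : ∀ i, 0 ≤ σ i) (hσord : ∀ i j : Fin r, i ≤ j → σ j ≤ σ i)
    (hw0 : ∀ i, 0 ≤ w i) (hword : ∀ i j : Fin r, i ≤ j → w i ≤ w j)
    (hδ : ∀ i, IsLeast
      {d : ℝ | 0 ≤ d ∧ ∀ x : ℝ, 0 ≤ x → gobj (σ i) (w i) p d ≤ gobj (σ i) (w i) p x}
      (δ i)) :
    (∀ i, 0 ≤ δ i) ∧ (∀ i j : Fin r, i ≤ j → δ j ≤ δ i) ∧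
      ∀ e : Fin r → ℝ, (∀ i, 0 ≤ e i) → (∀ i j : Fin r, i ≤ j → e j ≤ e i) →
        ∑ i, gobj (σ i) (w i) p (δ i) ≤ ∑ i, gobj (σ i) (w i) p (e i) := by
  refine ⟨fun i => (hδ i).1.1, fun i j hij => ?_, fun e he _ => ?_⟩
  · exact isLeast_gobj_minimizer_le hp (hσord i j hij) (hword i j hij) (hδ i) (hδ j)
  · exact Finset.sum_le_sum fun i _ => (hδ i).1.2 (e i) (he i)
end

section
/- Let 0 < p < 1, w > 0, and σ > τ_p(w), and let δ* be the unique global minimizer of f_{σ,w,p} on [0,∞) (so δ* > 0 and δ* − σ + w p (δ*)^{p−1} = 0). Define the iteration δ^{(0)} = σ and δ^{(k+1)} = σ − w·p·(δ^{(k)})^{p−1}. Then for all k the iterates satisfy δ* ≤ δ^{(k+1)} ≤ δ^{(k)} (in particular all iterates are positive and the iteration is well defined), and δ^{(k)} converges to δ* as k → ∞. -/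
theorem strictConvexOn_rpow_of_neg {q : ℝ} (hq : q < 0) :
    StrictConvexOn ℝ (Set.Ioi 0) fun x : ℝ => x ^ q := by
  refine StrictMonoOn.strictConvexOn_of_deriv (convex_Ioi 0)
    (fun x hx => (Real.continuousAt_rpow_const x q (Or.inl (ne_of_gt hx))).continuousWithinAt) ?_
  rw [interior_Ioi]
  intro x hx y hy hxy
  have hx' : (0 : ℝ) < x := hx
  have hy' : (0 : ℝ) < y := hy
  rw [(Real.hasDerivAt_rpow_const (Or.inl hx'.ne')).deriv,
    (Real.hasDerivAt_rpow_const (Or.inl hy'.ne')).deriv]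
  exact mul_lt_mul_of_neg_left (Real.rpow_lt_rpow_of_neg hx' hxy (by linarith)) hq

theorem hasDerivAt_fobj (σ w p : ℝ) {x : ℝ} (hx : x ≠ 0) :
    HasDerivAt (fobj σ w p) (x - σ + w * p * x ^ (p - 1)) x := by
  have h := ((((hasDerivAt_id x).sub_const σ).pow 2).const_mul (1 / 2)).add
    ((Real.hasDerivAt_rpow_const (p := p) (Or.inl hx)).const_mul w)
  refine h.congr_deriv ?_
  simp
  ring

/-- Between two positive stationary points the objective strictly decreases, because its
derivative is strictly convex. -/
theorem fobj_lt_of_stationary {σ w p a b : ℝ} (hp : 0 < p) (hp1 : p < 1) (hw : 0 < w)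
    (ha : 0 < a) (hab : a < b) (hfa : a - σ + w * p * a ^ (p - 1) = 0)
    (hfb : b - σ + w * p * b ^ (p - 1) = 0) : fobj σ w p b < fobj σ w p a := by
  refine strictAntiOn_of_deriv_neg (convex_Icc a b) (fun x hx => ?_) (fun x hx => ?_)
    (Set.left_mem_Icc.2 hab.le) (Set.right_mem_Icc.2 hab.le) hab
  · exact (hasDerivAt_fobj σ w p (ha.trans_le hx.1).ne').continuousAt.continuousWithinAt
  · rw [interior_Icc] at hx
    obtain ⟨hax, hxb⟩ := hx
    rw [(hasDerivAt_fobj σ w p (ha.trans hax).ne').deriv]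
    have hslope := (strictConvexOn_rpow_of_neg (q := p - 1) (by linarith)).slope_strict_mono_adjacent
      (Set.mem_Ioi.2 ha) (Set.mem_Ioi.2 (ha.trans (hax.trans hxb))) hax hxb
    rw [div_lt_div_iff₀ (by linarith) (by linarith)] at hslope
    have hwp : 0 < w * p := mul_pos hw hp
    have h := mul_lt_mul_of_pos_left hslope hwp
    have hba : 0 < b - a := by linarith
    by_contra! hn
    nlinarith [mul_nonneg hba.le hn]

/-- Convergence of the GST fixed-point iteration: for `0 < p < 1`, `w > 0`,
`σ > τ_p(w)`, let `δ*` be the unique global minimizer of `f_{σ,w,p}` on `[0,∞)`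
(so `δ* > 0` and `δ* − σ + w p (δ*)^{p−1} = 0`). The iteration `δ⁽⁰⁾ = σ`,
`δ⁽ᵏ⁺¹⁾ = σ − w·p·(δ⁽ᵏ⁾)^{p−1}` satisfies `δ* ≤ δ⁽ᵏ⁺¹⁾ ≤ δ⁽ᵏ⁾` for all `k`
(in particular all iterates are positive), and `δ⁽ᵏ⁾ → δ*` as `k → ∞`. -/
theorem gst_iteration_converges (p w σ δstar : ℝ) (seq : ℕ → ℝ)
    (hp : 0 < p) (hp1 : p < 1) (hw : 0 < w) (hστ : gstThreshold p w < σ)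
    (hpos : 0 < δstar)
    (hstat : δstar - σ + w * p * δstar ^ (p - 1) = 0)
    (hmin : ∀ δ : ℝ, 0 ≤ δ → fobj σ w p δstar ≤ fobj σ w p δ)
    (hseq0 : seq 0 = σ)
    (hseq : ∀ k, seq (k + 1) = σ - w * p * seq k ^ (p - 1)) :
    (∀ k, 0 < seq k) ∧ (∀ k, δstar ≤ seq (k + 1) ∧ seq (k + 1) ≤ seq k) ∧
      Filter.Tendsto seq Filter.atTop (nhds δstar) := by
  have hwp : 0 < w * p := mul_pos hw hp
  have hanti : ∀ {x y : ℝ}, 0 < x → x ≤ y → w * p * y ^ (p - 1) ≤ w * p * x ^ (p - 1) :=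
    fun hx hxy => mul_le_mul_of_nonneg_left
      (Real.rpow_le_rpow_of_nonpos hx hxy (by linarith)) hwp.le
  have hlower : ∀ k, δstar ≤ seq k := by
    intro k
    induction k with
    | zero =>
      have := mul_pos hwp (Real.rpow_pos_of_pos hpos (p - 1))
      linarith
    | succ k ih =>
      have := hanti hpos ih
      rw [hseq]
      linarith
  have hseqpos : ∀ k, 0 < seq k := fun k => hpos.trans_le (hlower k)
  have hstep : ∀ k, seq (k + 1) ≤ seq k := by
    intro k
    induction k with
    | zero =>
      have := mul_pos hwp (Real.rpow_pos_of_pos (hseqpos 0) (p - 1))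
      rw [hseq]
      linarith
    | succ k ih =>
      have := hanti (hseqpos (k + 1)) ih
      rw [hseq (k + 1)]
      linarith [hseq k]
  refine ⟨hseqpos, fun k => ⟨hlower (k + 1), hstep k⟩, ?_⟩
  have hlim := tendsto_atTop_ciInf (antitone_nat_of_succ_le hstep)
    ⟨δstar, Set.forall_mem_range.2 hlower⟩
  set L := ⨅ k, seq k
  have hL : δstar ≤ L := le_ciInf hlower
  have hLpos : 0 < L := hpos.trans_le hL
  have hnext : Filter.Tendsto (fun k => seq (k + 1)) Filter.atTop
      (nhds (σ - w * p * L ^ (p - 1))) := by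
    simp only [hseq]
    exact ((hlim.rpow_const (Or.inl hLpos.ne')).const_mul (w * p)).const_sub σ
  have hfix : L = σ - w * p * L ^ (p - 1) :=
    tendsto_nhds_unique (hlim.comp (Filter.tendsto_add_atTop_nat 1)) hnext
  rcases hL.eq_or_lt with h | h
  · rwa [h]
  · exact absurd (hmin L hLpos.le)
      (fobj_lt_of_stationary hp hp1 hw hpos h hstat (by linarith)).not_ge
end

section
/- Let 0 < p < 1, 0 < w₁ ≤ w₂, and σ > τ_p(w₂). Define two iterations a^{(0)} = b^{(0)} = σ, a^{(k+1)} = σ − w₁·p·(a^{(k)})^{p−1} and b^{(k+1)} = σ − w₂·p·(b^{(k)})^{p−1}. Then for every k ≥ 0 both iterates are positive and a^{(k)} ≥ b^{(k)}. -/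
/-- Let `0 < p < 1`, `0 < w₁ ≤ w₂` and `σ > τ_p(w₂)`. For the two GST iterations
`a⁽⁰⁾ = b⁽⁰⁾ = σ`, `a⁽ᵏ⁺¹⁾ = σ − w₁·p·(a⁽ᵏ⁾)^{p−1}`, `b⁽ᵏ⁺¹⁾ = σ − w₂·p·(b⁽ᵏ⁾)^{p−1}`,
every iterate is positive and `a⁽ᵏ⁾ ≥ b⁽ᵏ⁾` for all `k`. -/
theorem gst_iterates_monotone_in_weight (p w₁ w₂ σ : ℝ) (a b : ℕ → ℝ)
    (hp : 0 < p) (hp1 : p < 1) (hw₁ : 0 < w₁) (hw : w₁ ≤ w₂)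
    (hστ : gstThreshold p w₂ < σ)
    (ha0 : a 0 = σ) (hb0 : b 0 = σ)
    (ha : ∀ k, a (k + 1) = σ - w₁ * p * a k ^ (p - 1))
    (hb : ∀ k, b (k + 1) = σ - w₂ * p * b k ^ (p - 1)) :
    ∀ k, 0 < a k ∧ 0 < b k ∧ b k ≤ a k := by
  have hw₂ : 0 < w₂ := hw₁.trans_le hw
  have hbase : 0 < 2 * w₂ * (1 - p) := mul_pos (by positivity) (sub_pos.mpr hp1)
  set c := (2 * w₂ * (1 - p)) ^ (1 / (2 - p)) with hc
  have hc0 : 0 < c := Real.rpow_pos_of_pos hbase _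
  have hcp : (2 * w₂ * (1 - p)) ^ ((p - 1) / (2 - p)) = c ^ (p - 1) := by
    rw [hc, ← Real.rpow_mul hbase.le, one_div_mul_eq_div]
  have hσ : c + w₂ * p * c ^ (p - 1) < σ := by
    rwa [gstThreshold, ← hc, hcp] at hστ
  have hcσ : c ≤ σ := by
    have : 0 < w₂ * p * c ^ (p - 1) := by positivity
    linarith
  have key : ∀ k, c ≤ b k ∧ b k ≤ a k := by
    intro k
    induction k with
    | zero => exact ⟨hb0 ▸ hcσ, (hb0.trans ha0.symm).le⟩
    | succ k ih =>
      obtain ⟨hcb, hba⟩ := ih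
      have hb_pos : 0 < b k := hc0.trans_le hcb
      have ha_pos : 0 < a k := hb_pos.trans_le hba
      rw [ha, hb]
      constructor
      · have h : w₂ * p * b k ^ (p - 1) ≤ w₂ * p * c ^ (p - 1) :=
          mul_le_mul_of_nonneg_left
            (Real.rpow_le_rpow_of_nonpos hc0 hcb (by linarith)) (by positivity)
        linarith
      · have h : a k ^ (p - 1) ≤ b k ^ (p - 1) :=
          Real.rpow_le_rpow_of_nonpos hb_pos hba (by linarith)
        gcongr
  intro k
  obtain ⟨hcb, hba⟩ := key k
  have hb_pos : 0 < b k := hc0.trans_le hcb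
  exact ⟨hb_pos.trans_le hba, hb_pos, hba⟩
end

section
/- Let Y be a fixed real m×n matrix, let μ₀ > 0 and ρ > 1, and set μ_k = μ₀·ρ^k. Suppose real m×n matrix sequences (X_k), (E_k), (Z_k) satisfy the multiplier update Z_{k+1} = Z_k + μ_k·(Y − X_{k+1} − E_{k+1}) for all k, and suppose the sequence (Z_k) is bounded in Frobenius norm. Then ‖Y − X_k − E_k‖_F → 0 as k → ∞; i.e., every accumulation point (X, E) of the sequence satisfies the feasibility constraint Y = X + E. -/
open Matrix

/-- The squared Frobenius norm of a real matrix: the sum of squares of its entries. -/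
noncomputable def frobSq {m n : ℕ} (M : Matrix (Fin m) (Fin n) ℝ) : ℝ :=
  ∑ i, ∑ j, (M i j) ^ 2

/-- The Frobenius norm of a real matrix. -/
noncomputable def frobNorm {m n : ℕ} (M : Matrix (Fin m) (Fin n) ℝ) : ℝ :=
  Real.sqrt (frobSq M)

theorem abs_apply_le_frobNorm {m n : ℕ} (M : Matrix (Fin m) (Fin n) ℝ) (i : Fin m) (j : Fin n) :
    |M i j| ≤ frobNorm M := by
  refine Real.abs_le_sqrt ?_
  calc M i j ^ 2 ≤ ∑ j', M i j' ^ 2 :=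
        Finset.single_le_sum (f := fun j' => M i j' ^ 2) (fun _ _ => sq_nonneg _)
          (Finset.mem_univ j)
    _ ≤ frobSq M :=
        Finset.single_le_sum (f := fun i' => ∑ j', M i' j' ^ 2)
          (fun _ _ => Finset.sum_nonneg fun _ _ => sq_nonneg _) (Finset.mem_univ i)

theorem tendsto_frobNorm_zero {α : Type*} {l : Filter α} {m n : ℕ}
    {R : α → Matrix (Fin m) (Fin n) ℝ}
    (hR : ∀ i j, Filter.Tendsto (fun a => R a i j) l (nhds 0)) :
    Filter.Tendsto (fun a => frobNorm (R a)) l (nhds 0) := by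
  have h : Filter.Tendsto (fun a => frobSq (R a)) l
      (nhds (∑ _i : Fin m, ∑ _j : Fin n, (0 : ℝ) ^ 2)) :=
    tendsto_finsetSum _ fun i _ => tendsto_finsetSum _ fun j _ => (hR i j).pow 2
  simpa [frobNorm] using h.sqrt

/-- Feasibility part of the convergence analysis of the ALM iteration for WSNM-RPCA:
if the multipliers are updated by `Z_{k+1} = Z_k + μ_k (Y − X_{k+1} − E_{k+1})` with
penalty `μ_k = μ₀ ρ^k` (`μ₀ > 0`, `ρ > 1`) and `(Z_k)` is bounded in Frobenius norm,
then `‖Y − X_k − E_k‖_F → 0` as `k → ∞`. -/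
theorem alm_feasibility {m n : ℕ} (Y : Matrix (Fin m) (Fin n) ℝ)
    (μ₀ ρ : ℝ) (hμ₀ : 0 < μ₀) (hρ : 1 < ρ)
    (X E Z : ℕ → Matrix (Fin m) (Fin n) ℝ)
    (hZ : ∀ k : ℕ, Z (k + 1) = Z k + (μ₀ * ρ ^ k) • (Y - X (k + 1) - E (k + 1)))
    (hbound : ∃ C : ℝ, ∀ k : ℕ, frobNorm (Z k) ≤ C) :
    Filter.Tendsto (fun k => frobNorm (Y - X k - E k)) Filter.atTop (nhds 0) := by
  obtain ⟨C, hC⟩ := hbound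
  rw [← Filter.tendsto_add_atTop_iff_nat 1]
  refine tendsto_frobNorm_zero fun i j => ?_
  have hμ : Filter.Tendsto (fun k : ℕ => μ₀ * ρ ^ k) Filter.atTop Filter.atTop :=
    (tendsto_pow_atTop_atTop_of_one_lt hρ).const_mul_atTop hμ₀
  refine squeeze_zero_norm (fun k => ?_) (hμ.const_div_atTop (2 * C))
  have hpos : 0 < μ₀ * ρ ^ k := by positivity
  have hentry : Z (k + 1) i j = Z k i j + μ₀ * ρ ^ k * (Y - X (k + 1) - E (k + 1)) i j := by
    simpa using congrFun (congrFun (hZ k) i) j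
  have h₀ := abs_le.mp ((abs_apply_le_frobNorm (Z k) i j).trans (hC k))
  have h₁ := abs_le.mp ((abs_apply_le_frobNorm (Z (k + 1)) i j).trans (hC (k + 1)))
  rw [Real.norm_eq_abs, le_div_iff₀ hpos, ← abs_of_pos hpos, ← abs_mul, abs_le]
  constructor <;> linarith
end
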